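/- Let q ∈ 𝕆 be a nonzero octonion and let L_q : 𝕆 → 𝕆 be the left multiplication operator x ↦ qx, regarded as a bounded right para-linear operator on the Banach 𝕆-bimodule 𝕆. Then: (1) L_q is power-associative; (2) the real-linear operator R_s − L_q on 𝕆 is invertible if and only if s ∉ [q] := {Re q + |Im q|·J : J ∈ 𝕊}; (3) for J ∈ 𝕊 and s ∈ ℂ_J with Q_s(q) := q² − 2(Re s)q + |s|² ≠ 0, the right regular inverse satisfies (R_s − L_q)^{⊚−} = L_{Q_s(q)^{−1}(s̄ − q)}; (4) the pull-back spectrum of L_q is σ*(L_q) = [q]. -/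

import Mathlib

noncomputable section

open scoped BigOperators

/-- Octonions, realized via the Cayley–Dickson doubling of the quaternions. -/
@[ext]
structure Oct : Type where
  a : Quaternion ℝ
  b : Quaternion ℝ

namespace Oct

instance : Zero Oct := ⟨⟨0, 0⟩⟩
instance : Add Oct := ⟨fun x y => ⟨x.a + y.a, x.b + y.b⟩⟩
instance : Neg Oct := ⟨fun x => ⟨-x.a, -x.b⟩⟩
instance : Sub Oct := ⟨fun x y => ⟨x.a - y.a, x.b - y.b⟩⟩
instance : SMul ℕ Oct := ⟨fun n x => ⟨n • x.a, n • x.b⟩⟩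
instance : SMul ℤ Oct := ⟨fun n x => ⟨n • x.a, n • x.b⟩⟩
instance : SMul ℝ Oct := ⟨fun r x => ⟨r • x.a, r • x.b⟩⟩

def toLp (x : Oct) : WithLp 2 (Quaternion ℝ × Quaternion ℝ) :=
  (WithLp.equiv 2 (Quaternion ℝ × Quaternion ℝ)).symm (x.a, x.b)

lemma toLp_injective : Function.Injective toLp := by
  rintro ⟨xa, xb⟩ ⟨ya, yb⟩ h
  have ha : xa = ya :=
    congrArg (fun z => (WithLp.equiv 2 (Quaternion ℝ × Quaternion ℝ) z).1) h
  have hb : xb = yb :=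
    congrArg (fun z => (WithLp.equiv 2 (Quaternion ℝ × Quaternion ℝ) z).2) h
  subst ha; subst hb; rfl

instance : AddCommGroup Oct :=
  toLp_injective.addCommGroup toLp rfl (fun _ _ => rfl) (fun _ => rfl) (fun _ _ => rfl)
    (fun _ _ => rfl) (fun _ _ => rfl)

def toLpHom : Oct →+ WithLp 2 (Quaternion ℝ × Quaternion ℝ) where
  toFun := toLp
  map_zero' := rfl
  map_add' _ _ := rfl

instance : Module ℝ Oct := toLp_injective.module ℝ toLpHom fun _ _ => rfl

instance : NormedAddCommGroup Oct :=
  NormedAddCommGroup.induced Oct (WithLp 2 (Quaternion ℝ × Quaternion ℝ)) toLpHom toLp_injective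

instance : NormedSpace ℝ Oct := ⟨fun r x => norm_smul_le r (toLp x)⟩

def toProdLin : Oct →ₗ[ℝ] Quaternion ℝ × Quaternion ℝ where
  toFun x := (x.a, x.b)
  map_add' _ _ := rfl
  map_smul' _ _ := rfl

lemma toProdLin_injective : Function.Injective toProdLin := by
  rintro ⟨xa, xb⟩ ⟨ya, yb⟩ h
  have ha : xa = ya := congrArg Prod.fst h
  have hb : xb = yb := congrArg Prod.snd h
  subst ha; subst hb; rfl

instance : FiniteDimensional ℝ Oct :=
  FiniteDimensional.of_injective toProdLin toProdLin_injective

instance : CompleteSpace Oct := FiniteDimensional.complete ℝ Oct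

instance : One Oct := ⟨⟨1, 0⟩⟩

instance : Mul Oct :=
  ⟨fun x y => ⟨x.a * y.a - star y.b * x.b, y.b * x.a + x.b * star y.a⟩⟩

/-- Octonionic conjugation. -/
def conj (x : Oct) : Oct := ⟨star x.a, -x.b⟩

/-- The real part of an octonion. -/
def re (x : Oct) : ℝ := x.a.re

/-- Powers of an octonion (association chosen on the left factor). -/
def opow (s : Oct) : ℕ → Oct
  | 0 => 1
  | n + 1 => s * opow s n

/-- The inverse of a nonzero octonion. -/
def oinv (s : Oct) : Oct := (‖s‖ ^ 2)⁻¹ • conj s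

/-- `invPow s n` is the octonion `s ^ (-1 - n)`. -/
def invPow (s : Oct) (n : ℕ) : Oct := opow (oinv s) (n + 1)

def eNat : ℕ → Oct
  | 0 => ⟨1, 0⟩
  | 1 => ⟨⟨0, 1, 0, 0⟩, 0⟩
  | 2 => ⟨⟨0, 0, 1, 0⟩, 0⟩
  | 3 => ⟨⟨0, 0, 0, 1⟩, 0⟩
  | 4 => ⟨0, 1⟩
  | 5 => ⟨0, ⟨0, 1, 0, 0⟩⟩
  | 6 => ⟨0, ⟨0, 0, 1, 0⟩⟩
  | 7 => ⟨0, ⟨0, 0, 0, 1⟩⟩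
  | _ => 0

/-- The standard basis `e_0 = 1, e_1, …, e_7` of the octonions. -/
def e (i : Fin 8) : Oct := eNat i.val

/-- The six-dimensional sphere `𝕊` of imaginary units of `𝕆`. -/
def unitSphere : Set Oct := {J | J * J = -1}

/-- The slice `ℂ_J = ℝ ⊕ ℝJ` of the octonions. -/
def sliceC (J : Oct) : Set Oct := {s | ∃ x y : ℝ, s = x • (1 : Oct) + y • J}

/-- The embedding of `ℂ` onto the slice `ℂ_J`, `x + y i ↦ x + y J`. -/
def toSlice (J : Oct) (z : ℂ) : Oct := z.re • (1 : Oct) + z.im • J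

end Oct

open Oct

/-- A (normed/Banach) `𝕆`-bimodule: a real normed space with continuous real-bilinear left and
right octonionic multiplications satisfying the alternativity relations
`[p,q,x] = [q,x,p] = [x,p,q] = -[q,p,x]` and the norm identities `‖px‖ = |p|‖x‖ = ‖xp‖`. -/
class OctBimodule (V : Type*) [NormedAddCommGroup V] [NormedSpace ℝ V] : Type _ where
  lm : Oct →ₗ[ℝ] V →L[ℝ] V
  rm : Oct →ₗ[ℝ] V →L[ℝ] V
  lm_one : ∀ x : V, lm 1 x = x
  rm_one : ∀ x : V, rm 1 x = x
  /-- `[p,q,x] = [q,x,p]` -/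
  assoc_cyc₁ : ∀ (p q : Oct) (x : V),
    lm (p * q) x - lm p (lm q x) = rm p (lm q x) - lm q (rm p x)
  /-- `[p,q,x] = [x,p,q]` -/
  assoc_cyc₂ : ∀ (p q : Oct) (x : V),
    lm (p * q) x - lm p (lm q x) = rm q (rm p x) - rm (p * q) x
  /-- `[p,q,x] = -[q,p,x]` -/
  assoc_alt : ∀ (p q : Oct) (x : V),
    lm (p * q) x - lm p (lm q x) = -(lm (q * p) x - lm q (lm p x))
  norm_lm : ∀ (p : Oct) (x : V), ‖lm p x‖ = ‖p‖ * ‖x‖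
  norm_rm : ∀ (p : Oct) (x : V), ‖rm p x‖ = ‖p‖ * ‖x‖

section OctMod

variable {V : Type*} [NormedAddCommGroup V] [NormedSpace ℝ V] [OctBimodule V]

/-- Left multiplication `x ↦ p x` as a bounded real-linear operator. -/
def lmo (p : Oct) : V →L[ℝ] V := OctBimodule.lm p

/-- Right multiplication `R_p : x ↦ x p` as a bounded real-linear operator. -/
def rmo (p : Oct) : V →L[ℝ] V := OctBimodule.rm p

variable (V)

/-- The real-part projection `Re x = (5/12) x - (1/12) ∑_{i=1}^7 e_i x e_i` of an
`𝕆`-bimodule. -/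
def reO : V →L[ℝ] V :=
  (5 / 12 : ℝ) • ContinuousLinearMap.id ℝ V -
    (1 / 12 : ℝ) • ∑ i : Fin 7, (rmo (e i.succ)).comp (lmo (e i.succ))

/-- The real part `Re V` of an `𝕆`-bimodule, i.e. the set of associative central elements. -/
def ReSet : Set V :=
  {m | (∀ p q : Oct, lmo (p * q) m = lmo p (lmo q m)) ∧ ∀ p : Oct, lmo p m = rmo p m}

/-- The slice `ℂ_J(V) = Re V ⊕ J · Re V` of an `𝕆`-bimodule. -/
def CJV (J : Oct) : Set V :=
  {x | ∃ u ∈ ReSet V, ∃ w ∈ ReSet V, x = u + lmo J w}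

/-- The slice projection `π_J(x) = Re x + J Re (J̄ x)`. -/
def piJ (J : Oct) : V →L[ℝ] V :=
  reO V + (lmo J).comp ((reO V).comp (lmo (Oct.conj J)))

variable {V}

/-- The second right associator `B_p(T, x) = T(x) p - T(x p)` of an operator. -/
def Bop (p : Oct) (T : V →L[ℝ] V) : V →L[ℝ] V := (rmo p).comp T - T.comp (rmo p)

/-- A bounded real-linear operator is right (octonionic) para-linear if `Re B_p(T,x) = 0`. -/
def IsRightPara (T : V →L[ℝ] V) : Prop := ∀ (p : Oct) (x : V), reO V (Bop p T x) = 0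

/-- The left octonionic scalar multiplication `(p ⊙ T)(x) = p T(x) + B_p(T,x)` on operators. -/
def odotL (p : Oct) (T : V →L[ℝ] V) : V →L[ℝ] V := (lmo p).comp T + Bop p T

/-- The right octonionic scalar multiplication `(T ⊙ p)(x) = T(p x) - B_p(T,x)` on operators. -/
def odotR (T : V →L[ℝ] V) (p : Oct) : V →L[ℝ] V := T.comp (lmo p) - Bop p T

/-- The lifting map, `(lif F)(x) = ∑_i F(x ē_i) e_i`. -/
def lifO (F : V →L[ℝ] V) : V →L[ℝ] V :=
  ∑ i : Fin 8, (rmo (e i)).comp (F.comp (rmo (Oct.conj (e i))))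

/-- The extension map, `(ext G)(∑ x_i e_i) = ∑ G(x_i) e_i`, where `x_i = Re (x ē_i)`. -/
def extO (G : V →L[ℝ] V) : V →L[ℝ] V :=
  ∑ i : Fin 8, (rmo (e i)).comp (G.comp ((reO V).comp (rmo (Oct.conj (e i)))))

/-- The left regular power `T^{n⊚} = lif (Re ∘ Tⁿ)`. -/
def rpowL (T : V →L[ℝ] V) (n : ℕ) : V →L[ℝ] V := lifO ((reO V).comp (T ^ n))

/-- The right regular power `T^{⊚n} = ext (Tⁿ|_{Re V})`. -/
def rpowR (T : V →L[ℝ] V) (n : ℕ) : V →L[ℝ] V := extO (T ^ n)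

/-- The regular composition `f ⊚ g = lif (Re ∘ f ∘ g)`. -/
def rcomp (f g : V →L[ℝ] V) : V →L[ℝ] V := lifO ((reO V).comp (f.comp g))

/-- The composition associator `[f,g,x]_⊚ = (f ⊚ g)(x) - f(g(x))`. -/
def compAssoc (f g : V →L[ℝ] V) (x : V) : V := rcomp f g x - f (g x)

/-- The right regular inverse `T^{⊚-} = ext (T⁻¹|_{Re V})` of an invertible operator. -/
def rinvR (T : V →L[ℝ] V) : V →L[ℝ] V := extO (Ring.inverse T)

/-- The left regular inverse `T^{-⊚} = lif (Re ∘ T⁻¹)` of an invertible operator. -/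
def rinvL (T : V →L[ℝ] V) : V →L[ℝ] V := lifO ((reO V).comp (Ring.inverse T))

/-- An operator is power-associative if all of its (composition) powers are right
para-linear. -/
def IsPowerAssoc (T : V →L[ℝ] V) : Prop := ∀ n : ℕ, IsRightPara (T ^ n)

/-- A bounded operator is octonionic linear if `T(xp) = T(x)p` for all `p`. -/
def IsOctLinear (T : V →L[ℝ] V) : Prop := ∀ (p : Oct) (x : V), T (rmo p x) = rmo p (T x)

/-- `S` is `ℂ_J`-extendable power associative: `Sⁿ(v s) = Sⁿ(v) s` for `v ∈ Re V`,
`s ∈ ℂ_J`, `n ≥ 1`. -/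
def CJExtPA (J : Oct) (S : V →L[ℝ] V) : Prop :=
  ∀ n : ℕ, 1 ≤ n → ∀ v ∈ ReSet V, ∀ s ∈ sliceC J, (S ^ n) (rmo s v) = rmo s ((S ^ n) v)

/-- `S` is `ℂ_J`-liftable power associative: `Re (Sⁿ(v s)) = Re (Sⁿ(v) s)` for all `v ∈ V`,
`s ∈ ℂ_J`, `n ≥ 1`. -/
def CJLiftPA (J : Oct) (S : V →L[ℝ] V) : Prop :=
  ∀ n : ℕ, 1 ≤ n → ∀ (v : V), ∀ s ∈ sliceC J,
    reO V ((S ^ n) (rmo s v)) = reO V (rmo s ((S ^ n) v))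

/-- The pull-back slice-resolvent set `ρ*_J(T)`. -/
def pbResSlice (T : V →L[ℝ] V) (J : Oct) : Set Oct :=
  {s | s ∈ sliceC J ∧ IsUnit ((rmo s : V →L[ℝ] V) - T) ∧
    CJExtPA J (Ring.inverse ((rmo s : V →L[ℝ] V) - T))}

/-- The pull-back resolvent set `ρ*(T)`. -/
def pbRes (T : V →L[ℝ] V) : Set Oct := ⋃ J ∈ unitSphere, pbResSlice T J

/-- The pull-back spectrum `σ*(T) = 𝕆 ∖ ρ*(T)`. -/
def pbSpec (T : V →L[ℝ] V) : Set Oct := Set.univ \ pbRes T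

/-- The push-forward slice-resolvent set `ρ_{*J}(T)`. -/
def pfResSlice (T : V →L[ℝ] V) (J : Oct) : Set Oct :=
  {s | s ∈ sliceC J ∧ IsUnit ((rmo s : V →L[ℝ] V) - T) ∧
    CJLiftPA J (Ring.inverse ((rmo s : V →L[ℝ] V) - T))}

/-- The push-forward resolvent set `ρ_*(T)`. -/
def pfRes (T : V →L[ℝ] V) : Set Oct := ⋃ J ∈ unitSphere, pfResSlice T J

/-- The push-forward spectrum `σ_*(T) = 𝕆 ∖ ρ_*(T)`. -/
def pfSpec (T : V →L[ℝ] V) : Set Oct := Set.univ \ pfRes T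

/-- The real-part projection of the `𝕆`-bimodule `𝓑_RO(V)` of bounded right para-linear
operators, given by `Re A = (5/12) A - (1/12) ∑_{i=1}^7 (e_i ⊙ A) ⊙ e_i`. -/
def reOpB (A : V →L[ℝ] V) : V →L[ℝ] V :=
  (5 / 12 : ℝ) • A - (1 / 12 : ℝ) • ∑ i : Fin 7, odotR (odotL (e i.succ) A) (e i.succ)

end OctMod

/-- A set `U ⊆ 𝕆` is slice-open if `U ∩ ℂ_J` is open in `ℂ_J` for every `J ∈ 𝕊`. -/
def SliceOpen (U : Set Oct) : Prop :=
  ∀ J ∈ unitSphere, IsOpen (Oct.toSlice J ⁻¹' U)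

/-- A parametrization of the boundary `∂(U ∩ ℂ_J)` by finitely many continuously
differentiable, positively oriented Jordan curves (positivity of the orientation is encoded
through the winding numbers). -/
structure SliceContour (J : Oct) (U : Set Oct) where
  n : ℕ
  γ : Fin n → ℝ → ℂ
  smooth : ∀ i, ContDiff ℝ 1 (γ i)
  closed : ∀ i, γ i 0 = γ i 1
  jordan : ∀ i, Set.InjOn (γ i) (Set.Ico (0 : ℝ) 1)
  image_eq : (⋃ i, γ i '' Set.Icc (0 : ℝ) 1) = frontier (Oct.toSlice J ⁻¹' U)
  winding_inside : ∀ z : ℂ, Oct.toSlice J z ∈ U →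
    (∑ i, ∫ t in (0 : ℝ)..1, deriv (γ i) t / (γ i t - z)) = 2 * (Real.pi : ℂ) * Complex.I
  winding_outside : ∀ z : ℂ, Oct.toSlice J z ∉ closure U →
    (∑ i, ∫ t in (0 : ℝ)..1, deriv (γ i) t / (γ i t - z)) = 0

/-- The integral `∫_{∂(U ∩ ℂ_J)} Φ(s, ds)` along a slice contour: the integrand gets the
point of the curve and its derivative (both in the coordinates of the slice). -/
def contourSum {J : Oct} {U : Set Oct} (Γ : SliceContour J U) {E : Type*}
    [NormedAddCommGroup E] [NormedSpace ℝ E] (Φ : ℂ → ℂ → E) : E :=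
  ∑ i, ∫ t in (0 : ℝ)..1, Φ (Γ.γ i t) (deriv (Γ.γ i) t)

/-- An axially symmetric slice domain (s-domain) in `𝕆`. -/
structure IsAdmissibleDomain (U : Set Oct) : Prop where
  isOpen : IsOpen U
  isConnected : IsConnected U
  real_nonempty : (U ∩ {s : Oct | ∃ r : ℝ, s = r • (1 : Oct)}).Nonempty
  axially : ∀ (z : ℂ), ∀ I ∈ unitSphere, ∀ J ∈ unitSphere,
    Oct.toSlice I z ∈ U → Oct.toSlice J z ∈ U
  slice_conn : ∀ J ∈ unitSphere, IsConnected (Oct.toSlice J ⁻¹' U)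

section Adm

variable {V : Type*} [NormedAddCommGroup V] [NormedSpace ℝ V] [OctBimodule V]

/-- A `T`-left-admissible domain: an axially symmetric s-domain containing the pull-back
spectrum `σ*(T)`.  (The regularity of its slice boundaries is witnessed by the slice
contours used in the integrals.) -/
def LeftAdmissible (T : V →L[ℝ] V) (U : Set Oct) : Prop :=
  IsAdmissibleDomain U ∧ pbSpec T ⊆ U

/-- A `T`-right-admissible domain: an axially symmetric s-domain containing the push-forward
spectrum `σ_*(T)`. -/
def RightAdmissible (T : V →L[ℝ] V) (U : Set Oct) : Prop :=
  IsAdmissibleDomain U ∧ pfSpec T ⊆ U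

end Adm

/-- The axially symmetric set `Ω_D ⊆ 𝕆` induced by a conjugation-invariant set `D ⊆ ℂ`. -/
def OmegaD (D : Set ℂ) : Set Oct := ⋃ J ∈ unitSphere, Oct.toSlice J '' D

/-- `F` is the stem of a slice preserving slice regular function on `Ω_D`: it is holomorphic
on the open conjugation-invariant set `D` and intertwines complex conjugation. -/
structure IsStem (D : Set ℂ) (F : ℂ → ℂ) : Prop where
  isOpen : IsOpen D
  conj_mem : ∀ z ∈ D, (starRingEnd ℂ) z ∈ D
  holo : DifferentiableOn ℂ F D
  conj_comm : ∀ z ∈ D, F ((starRingEnd ℂ) z) = (starRingEnd ℂ) (F z)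

section FC

variable {V : Type*} [NormedAddCommGroup V] [NormedSpace ℝ V] [OctBimodule V]

/-- The slice integral `(1/2π) ∫_{∂(U∩ℂ_J)} (R_s - T)^{⊚-} ⊙ (ds_J f(s))` defining the left
slice regular functional calculus of a slice preserving function with stem `F`. -/
def leftFC (T : V →L[ℝ] V) (J : Oct) {U : Set Oct} (Γ : SliceContour J U)
    (F : ℂ → ℂ) : V →L[ℝ] V :=
  (2 * Real.pi)⁻¹ • contourSum Γ fun z dz =>
    odotR (rinvR ((rmo (Oct.toSlice J z) : V →L[ℝ] V) - T))
      ((-(Oct.toSlice J dz) * J) * Oct.toSlice J (F z))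

/-- The slice integral `(1/2π) ∫_{∂(U∩ℂ_J)} (f(s) ds_J) ⊙ (R_s - T)^{-⊚}` defining the right
slice regular functional calculus of a slice preserving function with stem `F`. -/
def rightFC (T : V →L[ℝ] V) (J : Oct) {U : Set Oct} (Γ : SliceContour J U)
    (F : ℂ → ℂ) : V →L[ℝ] V :=
  (2 * Real.pi)⁻¹ • contourSum Γ fun z dz =>
    odotL (Oct.toSlice J (F z) * (-(Oct.toSlice J dz) * J))
      (rinvL ((rmo (Oct.toSlice J z) : V →L[ℝ] V) - T))

end FC

/-- The family of stems of the components, relative to `J = ∑ c_i e_i`, of a function of the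
form `f₀ + f₁ • J` with `f₀, f₁` slice preserving with stems `F₀, F₁`. -/
def stemFamily (c : Fin 8 → ℝ) (F₀ F₁ : ℂ → ℂ) : Fin 8 → ℂ → ℂ :=
  fun i z => if i = 0 then F₀ z else (c i : ℂ) * F₁ z

namespace Oct

/-- Left multiplication by an octonion, as a real-linear map. -/
def lmulLin (q : Oct) : Oct →ₗ[ℝ] Oct where
  toFun x := q * x
  map_add' x y := by
    refine Oct.ext ?_ ?_
    · show q.a * (x.a + y.a) - star (x.b + y.b) * q.b =
        (q.a * x.a - star x.b * q.b) + (q.a * y.a - star y.b * q.b)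
      rw [mul_add, star_add, add_mul]; abel
    · show (x.b + y.b) * q.a + q.b * star (x.a + y.a) =
        (x.b * q.a + q.b * star x.a) + (y.b * q.a + q.b * star y.a)
      rw [add_mul, star_add, mul_add]; abel
  map_smul' r x := by
    refine Oct.ext ?_ ?_
    · show q.a * (r • x.a) - star (r • x.b) * q.b = r • (q.a * x.a - star x.b * q.b)
      rw [mul_smul_comm, Quaternion.star_smul, smul_mul_assoc, smul_sub]
    · show (r • x.b) * q.a + q.b * star (r • x.a) = r • (x.b * q.a + q.b * star x.a)
      rw [smul_mul_assoc, Quaternion.star_smul, mul_smul_comm, smul_add]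

/-- Left multiplication `L_q : x ↦ q x` as a bounded real-linear operator on `𝕆`. -/
def Lq (q : Oct) : Oct →L[ℝ] Oct := (lmulLin q).toContinuousLinearMap

/-- The two-sphere `[q] = {Re q + |Im q| J : J ∈ 𝕊}` associated with an octonion `q`. -/
def qSphere (q : Oct) : Set Oct :=
  {s | ∃ J ∈ unitSphere, s = Oct.re q • (1 : Oct) + ‖q - Oct.re q • (1 : Oct)‖ • J}

end Oct


namespace Oct

open scoped Quaternion

@[simp] lemma zero_a : (0 : Oct).a = 0 := rfl
@[simp] lemma zero_b : (0 : Oct).b = 0 := rfl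
@[simp] lemma one_a : (1 : Oct).a = 1 := rfl
@[simp] lemma one_b : (1 : Oct).b = 0 := rfl
@[simp] lemma add_a (x y : Oct) : (x + y).a = x.a + y.a := rfl
@[simp] lemma add_b (x y : Oct) : (x + y).b = x.b + y.b := rfl
@[simp] lemma sub_a (x y : Oct) : (x - y).a = x.a - y.a := rfl
@[simp] lemma sub_b (x y : Oct) : (x - y).b = x.b - y.b := rfl
@[simp] lemma neg_a (x : Oct) : (-x).a = -x.a := rfl
@[simp] lemma neg_b (x : Oct) : (-x).b = -x.b := rfl
@[simp] lemma smul_a (r : ℝ) (x : Oct) : (r • x).a = r • x.a := rfl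
@[simp] lemma smul_b (r : ℝ) (x : Oct) : (r • x).b = r • x.b := rfl
@[simp] lemma mul_a (x y : Oct) : (x * y).a = x.a * y.a - star y.b * x.b := rfl
@[simp] lemma mul_b (x y : Oct) : (x * y).b = y.b * x.a + x.b * star y.a := rfl
@[simp] lemma conj_a (x : Oct) : (conj x).a = star x.a := rfl
@[simp] lemma conj_b (x : Oct) : (conj x).b = -x.b := rfl

@[simp] lemma e_a_re (i : Fin 8) : (e i).a.re = if i = 0 then 1 else 0 := by
  fin_cases i <;> rfl
@[simp] lemma e_a_imI (i : Fin 8) : (e i).a.imI = if i = 1 then 1 else 0 := by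
  fin_cases i <;> rfl
@[simp] lemma e_a_imJ (i : Fin 8) : (e i).a.imJ = if i = 2 then 1 else 0 := by
  fin_cases i <;> rfl
@[simp] lemma e_a_imK (i : Fin 8) : (e i).a.imK = if i = 3 then 1 else 0 := by
  fin_cases i <;> rfl
@[simp] lemma e_b_re (i : Fin 8) : (e i).b.re = if i = 4 then 1 else 0 := by
  fin_cases i <;> rfl
@[simp] lemma e_b_imI (i : Fin 8) : (e i).b.imI = if i = 5 then 1 else 0 := by
  fin_cases i <;> rfl
@[simp] lemma e_b_imJ (i : Fin 8) : (e i).b.imJ = if i = 6 then 1 else 0 := by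
  fin_cases i <;> rfl
@[simp] lemma e_b_imK (i : Fin 8) : (e i).b.imK = if i = 7 then 1 else 0 := by
  fin_cases i <;> rfl

@[simp] lemma Lq_apply (q x : Oct) : Lq q x = q * x := rfl

local instance : NonAssocRing Oct :=
  { (inferInstance : AddCommGroup Oct) with
    mul := (· * ·)
    one := 1
    left_distrib := fun x y z => map_add (lmulLin x) y z
    right_distrib := fun x y z => by
      apply Oct.ext <;> (simp [mul_add, add_mul]; abel)
    zero_mul := fun x => by apply Oct.ext <;> simp
    mul_zero := fun x => map_zero (lmulLin x)
    one_mul := fun x => by apply Oct.ext <;> simp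
    mul_one := fun x => by apply Oct.ext <;> simp }

local instance : SMulCommClass ℝ Oct Oct := ⟨fun r x y => (map_smul (lmulLin x) r y).symm⟩

local instance : IsScalarTower ℝ Oct Oct := ⟨fun r x y => by
  apply Oct.ext <;> simp [smul_sub, smul_add]⟩

lemma norm_sq_eq (x : Oct) :
    ‖x‖ ^ 2 = x.a.re ^ 2 + x.a.imI ^ 2 + x.a.imJ ^ 2 + x.a.imK ^ 2 +
      (x.b.re ^ 2 + x.b.imI ^ 2 + x.b.imJ ^ 2 + x.b.imK ^ 2) := by
  have h : ‖x‖ ^ 2 = ‖x.a‖ ^ 2 + ‖x.b‖ ^ 2 := WithLp.prod_norm_sq_eq_of_L2 (toLp x)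
  simp only [h, ← Quaternion.normSq_eq_norm_mul_self, Quaternion.normSq_def', sq]

lemma ext_re {x y : Oct} (h₁ : x.a.re = y.a.re) (h₂ : x.a.imI = y.a.imI)
    (h₃ : x.a.imJ = y.a.imJ) (h₄ : x.a.imK = y.a.imK) (h₅ : x.b.re = y.b.re)
    (h₆ : x.b.imI = y.b.imI) (h₇ : x.b.imJ = y.b.imJ) (h₈ : x.b.imK = y.b.imK) : x = y :=
  Oct.ext (QuaternionAlgebra.ext ‹_› ‹_› ‹_› ‹_›) (QuaternionAlgebra.ext ‹_› ‹_› ‹_› ‹_›)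

lemma mul_self_eq (x : Oct) : x * x = (2 * re x) • x - ‖x‖ ^ 2 • (1 : Oct) := by
  rw [norm_sq_eq]
  apply ext_re <;> simp [re] <;> ring

lemma left_alternative (x y : Oct) : x * (x * y) = x * x * y := by
  apply ext_re <;> simp <;> ring

lemma right_alternative (x y : Oct) : y * x * x = y * (x * x) := by
  apply ext_re <;> simp <;> ring

lemma flexible (x y : Oct) : x * y * x = x * (y * x) := by
  apply ext_re <;> simp <;> ring

lemma conj_eq (x : Oct) : conj x = (2 * re x) • (1 : Oct) - x := by
  apply ext_re <;> simp [re] <;> ring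

lemma re_mul_assoc (x y z : Oct) : re (x * y * z) = re (x * (y * z)) := by
  simp [re]; ring

lemma norm_mul_sq (x y : Oct) : ‖x * y‖ ^ 2 = ‖x‖ ^ 2 * ‖y‖ ^ 2 := by
  simp only [norm_sq_eq]
  simp
  ring

lemma re_conj_mul_mul_right (x s : Oct) : re (conj x * (x * s)) = ‖x‖ ^ 2 * re s := by
  rw [norm_sq_eq]; simp [re]; ring

lemma re_conj_mul_mul_left (x q : Oct) : re (conj x * (q * x)) = ‖x‖ ^ 2 * re q := by
  rw [norm_sq_eq]; simp [re]; ring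

lemma norm_sub_re_sq (x : Oct) : ‖x - re x • (1 : Oct)‖ ^ 2 = ‖x‖ ^ 2 - re x ^ 2 := by
  simp only [norm_sq_eq]; simp [re]; ring

lemma eq_re_smul_one_of_commute {x : Oct} (h : ∀ y, y * x = x * y) : x = re x • (1 : Oct) := by
  have h₁ := h (e 1)
  have h₂ := h (e 2)
  simp [Oct.ext_iff, Quaternion.ext_iff] at h₁ h₂
  apply ext_re <;> simp [re] <;> linarith

lemma sum_re_smul_e (y : Oct) : ∑ i, re (y * conj (e i)) • e i = y := by
  simp only [Fin.sum_univ_eight]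
  apply ext_re <;> simp [re]

lemma norm_one_sq : ‖(1 : Oct)‖ ^ 2 = 1 := by
  rw [norm_sq_eq]; simp

lemma re_eq_zero_and_norm_eq_one_of_mem_unitSphere {J : Oct} (hJ : J ∈ unitSphere) :
    re J = 0 ∧ ‖J‖ = 1 := by
  have hJ : J * J = -1 := hJ
  have hn : ‖J‖ ^ 2 = 1 := by
    have h := norm_mul_sq J J
    rw [hJ, norm_neg, norm_one_sq] at h
    nlinarith [sq_nonneg ‖J‖]
  have h : (2 * re J) • J = 0 := by
    have h := mul_self_eq J
    rw [hJ, hn, one_smul] at h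
    rw [← sub_eq_zero] at h; rw [← neg_eq_zero, ← h]; abel
  have hJ0 : J ≠ 0 := by
    rintro rfl
    simp at hn
  refine ⟨by simpa [hJ0] using h, ?_⟩
  nlinarith [norm_nonneg J]

lemma mem_unitSphere_of_re_eq_zero {J : Oct} (h : re J = 0) (hn : ‖J‖ = 1) :
    J ∈ unitSphere := by
  change J * J = -1
  simp [mul_self_eq J, h, hn]

lemma re_smul_one_add (a : ℝ) (x : Oct) : re (a • (1 : Oct) + x) = a + re x := by
  simp [re]

lemma re_smul (a : ℝ) (x : Oct) : re (a • x) = a * re x := rfl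

lemma mem_qSphere_iff {q s : Oct} : s ∈ qSphere q ↔ re s = re q ∧ ‖s‖ = ‖q‖ := by
  constructor
  · rintro ⟨J, hJ, rfl⟩
    obtain ⟨hJ0, hJ1⟩ := re_eq_zero_and_norm_eq_one_of_mem_unitSphere hJ
    have hre : re (re q • (1 : Oct) + ‖q - re q • (1 : Oct)‖ • J) = re q := by
      rw [re_smul_one_add, re_smul, hJ0, mul_zero, add_zero]
    refine ⟨hre, (sq_eq_sq₀ (norm_nonneg _) (norm_nonneg _)).1 ?_⟩
    have h := norm_sub_re_sq (re q • (1 : Oct) + ‖q - re q • (1 : Oct)‖ • J)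
    rw [hre, add_sub_cancel_left, norm_smul, hJ1, norm_norm, mul_one, norm_sub_re_sq] at h
    linarith
  · rintro ⟨hre, hn⟩
    have hIm : ‖s - re s • (1 : Oct)‖ = ‖q - re q • (1 : Oct)‖ :=
      (sq_eq_sq₀ (norm_nonneg _) (norm_nonneg _)).1 (by
        rw [norm_sub_re_sq, norm_sub_re_sq, hre, hn])
    by_cases h0 : ‖s - re s • (1 : Oct)‖ = 0
    · refine ⟨e 1, mem_unitSphere_of_re_eq_zero (by simp [re]) ?_, ?_⟩
      · have : ‖e 1‖ ^ 2 = 1 := by rw [norm_sq_eq]; simp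
        nlinarith [norm_nonneg (e 1)]
      · rw [← hIm, h0, ← hre, zero_smul, add_zero]
        exact sub_eq_zero.1 (norm_eq_zero.1 h0)
    · refine ⟨‖s - re s • (1 : Oct)‖⁻¹ • (s - re s • (1 : Oct)),
        mem_unitSphere_of_re_eq_zero ?_ ?_, ?_⟩
      · simp [re]
      · rw [norm_smul, norm_inv, norm_norm, inv_mul_cancel₀ h0]
      · rw [← hIm, smul_smul, mul_inv_cancel₀ h0, ← hre, one_smul, add_sub_cancel]

lemma mem_qSphere_of_mul_eq_mul {q s x : Oct} (hx : x ≠ 0) (h : x * s = q * x) :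
    s ∈ qSphere q := by
  have hx2 : ‖x‖ ^ 2 ≠ 0 := by simpa using hx
  refine mem_qSphere_iff.2 ⟨mul_left_cancel₀ hx2 ?_, ?_⟩
  · rw [← re_conj_mul_mul_right, h, re_conj_mul_mul_left]
  · refine (sq_eq_sq₀ (norm_nonneg _) (norm_nonneg _)).1 (mul_left_cancel₀ hx2 ?_)
    rw [← norm_mul_sq, h, norm_mul_sq, mul_comm]

lemma exists_mul_eq_mul_of_mem_qSphere {q s : Oct} (hs : s ∈ qSphere q) :
    ∃ x : Oct, x ≠ 0 ∧ x * s = q * x := by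
  obtain ⟨hre, hn⟩ := mem_qSphere_iff.1 hs
  have hone : (1 : Oct) ≠ 0 := fun h => by simpa [h] using norm_one_sq
  by_cases hq : q - conj s = 0
  · have hs' : s = (2 * re q) • (1 : Oct) - q := by
      have h := sub_eq_zero.1 hq
      rw [conj_eq, hre, eq_sub_iff_add_eq] at h
      rw [eq_sub_iff_add_eq, add_comm, h]
    by_cases hc : ∀ y, y * q = q * y
    · refine ⟨1, hone, ?_⟩
      have h := eq_re_smul_one_of_commute hc
      rw [one_mul, mul_one, hs', mul_smul, ← h, two_smul, add_sub_cancel_right]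
    · push Not at hc
      obtain ⟨y, hy⟩ := hc
      refine ⟨q * y - y * q, sub_ne_zero.2 hy.symm, ?_⟩
      rw [hs', mul_sub, mul_smul_comm, mul_one, sub_mul, mul_sub, flexible, right_alternative,
        left_alternative, mul_self_eq q]
      simp only [sub_mul, mul_sub, smul_mul_assoc, mul_smul_comm, one_mul, mul_one, smul_sub]
      abel
  · refine ⟨q - conj s, hq, ?_⟩
    rw [conj_eq, hre]
    simp only [sub_mul, mul_sub, smul_mul_assoc, mul_smul_comm, one_mul, mul_one, mul_self_eq,
      hre, hn]
    abel

lemma qpoly_eq_zero_of_mem_qSphere {q s : Oct} (h : s ∈ qSphere q) :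
    q * q - (2 * re s) • q + (‖s‖ ^ 2) • (1 : Oct) = 0 := by
  obtain ⟨hre, hn⟩ := mem_qSphere_iff.1 h
  rw [mul_self_eq, hre, hn]; abel

lemma oinv_mul_self {u : Oct} (hu : u ≠ 0) : oinv u * u = 1 := by
  have h : conj u * u = ‖u‖ ^ 2 • (1 : Oct) := by
    rw [conj_eq, sub_mul, smul_mul_assoc, one_mul, mul_self_eq]; abel
  rw [oinv, smul_mul_assoc, h, smul_smul, inv_mul_cancel₀ (by simpa using hu), one_smul]

/-- The slice inverse `Q_s(q)⁻¹ (s̄ - q)` solves `x s - q x = 1`. -/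
lemma oinv_qpoly_mul_solves {q s : Oct}
    (hQ : q * q - (2 * re s) • q + (‖s‖ ^ 2) • (1 : Oct) ≠ 0) :
    oinv (q * q - (2 * re s) • q + (‖s‖ ^ 2) • (1 : Oct)) * (conj s - q) * s -
      q * (oinv (q * q - (2 * re s) • q + (‖s‖ ^ 2) • (1 : Oct)) * (conj s - q)) = 1 := by
  set Q := q * q - (2 * re s) • q + (‖s‖ ^ 2) • (1 : Oct) with hQdef
  have hinv := oinv_mul_self hQ
  obtain ⟨a, b, hu⟩ : ∃ a b : ℝ, oinv Q = a • (1 : Oct) + b • q := by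
    refine ⟨(‖Q‖ ^ 2)⁻¹ * (2 * re Q + ‖q‖ ^ 2 - ‖s‖ ^ 2),
      (‖Q‖ ^ 2)⁻¹ * (2 * re s - 2 * re q), ?_⟩
    rw [oinv, conj_eq]
    conv_lhs => enter [2, 2]; rw [hQdef, mul_self_eq]
    module
  rw [hu] at hinv ⊢
  refine Eq.trans ?_ hinv
  rw [hQdef, conj_eq]
  simp only [sub_mul, mul_sub, add_mul, mul_add, smul_mul_assoc, mul_smul_comm, one_mul, mul_one,
    smul_add, smul_sub, right_alternative s q, left_alternative q s, mul_self_eq q, mul_self_eq s]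
  module

lemma toSlice_add (J : Oct) (z w : ℂ) : toSlice J (z + w) = toSlice J z + toSlice J w := by
  simp only [toSlice, Complex.add_re, Complex.add_im]; module

lemma toSlice_sub (J : Oct) (z w : ℂ) : toSlice J (z - w) = toSlice J z - toSlice J w := by
  simp only [toSlice, Complex.sub_re, Complex.sub_im]; module

lemma toSlice_ofReal_mul (J : Oct) (r : ℝ) (z : ℂ) : toSlice J (r * z) = r • toSlice J z := by
  simp only [toSlice, Complex.re_ofReal_mul, Complex.im_ofReal_mul]; module

lemma mul_toSlice_mul_toSlice {J : Oct} (hJ : J ∈ unitSphere) (y : Oct) (z w : ℂ) :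
    y * toSlice J z * toSlice J w = y * toSlice J (z * w) := by
  have hJ : J * J = -1 := hJ
  simp only [toSlice, Complex.mul_re, Complex.mul_im, mul_add, add_mul, mul_smul_comm,
    smul_mul_assoc, mul_one, right_alternative J y, hJ, mul_neg]
  module

lemma toSlice_mul_toSlice {J : Oct} (hJ : J ∈ unitSphere) (z w : ℂ) :
    toSlice J z * toSlice J w = toSlice J (z * w) := by
  simpa using mul_toSlice_mul_toSlice hJ 1 z w

lemma re_toSlice {J : Oct} (hJ : J ∈ unitSphere) (z : ℂ) : re (toSlice J z) = z.re := by
  rw [toSlice, re_smul_one_add, re_smul, (re_eq_zero_and_norm_eq_one_of_mem_unitSphere hJ).1,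
    mul_zero, add_zero]

lemma norm_toSlice_sq {J : Oct} (hJ : J ∈ unitSphere) (z : ℂ) :
    ‖toSlice J z‖ ^ 2 = z.re ^ 2 + z.im ^ 2 := by
  have h := norm_sub_re_sq (toSlice J z)
  rw [re_toSlice hJ, toSlice, add_sub_cancel_left, norm_smul,
    (re_eq_zero_and_norm_eq_one_of_mem_unitSphere hJ).2, mul_one, Real.norm_eq_abs, sq_abs] at h
  rw [toSlice]
  linarith

lemma exists_mem_sliceC (s : Oct) : ∃ J ∈ unitSphere, ∃ z : ℂ, s = toSlice J z := by
  obtain ⟨J, hJ, h⟩ := mem_qSphere_iff.2 (⟨rfl, rfl⟩ : re s = re s ∧ ‖s‖ = ‖s‖)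
  exact ⟨J, hJ, ⟨re s, ‖s - re s • (1 : Oct)‖⟩, h⟩

/-- The element `z + q w` of `ℂ_J + q ℂ_J`. -/
def slicePair (q J : Oct) (z w : ℂ) : Oct := toSlice J z + q * toSlice J w

lemma slicePair_mul_toSlice {J : Oct} (hJ : J ∈ unitSphere) (q : Oct) (z w c : ℂ) :
    slicePair q J z w * toSlice J c = slicePair q J (z * c) (w * c) := by
  rw [slicePair, add_mul, toSlice_mul_toSlice hJ, mul_toSlice_mul_toSlice hJ, slicePair]

lemma mul_slicePair (q J : Oct) (z w : ℂ) :
    q * slicePair q J z w =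
      slicePair q J (-((‖q‖ ^ 2 : ℝ) * w)) (z + (2 * re q : ℝ) * w) := by
  simp only [slicePair, mul_add, left_alternative, mul_self_eq q, toSlice_add, ← neg_mul,
    ← Complex.ofReal_neg, toSlice_ofReal_mul, sub_mul, smul_mul_assoc, one_mul, mul_smul_comm]
  module

lemma slicePair_sub (q J : Oct) (z w z' w' : ℂ) :
    slicePair q J z w - slicePair q J z' w' = slicePair q J (z - z') (w - w') := by
  simp only [slicePair, toSlice_sub, mul_sub]; abel

lemma charpoly_ne_zero {q J : Oct} (hJ : J ∈ unitSphere) {c : ℂ}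
    (h : toSlice J c ∉ qSphere q) :
    c * c - (2 * re q : ℝ) * c + (‖q‖ ^ 2 : ℝ) ≠ 0 := by
  contrapose! h
  have him := congrArg Complex.im h
  have hre := congrArg Complex.re h
  simp only [Complex.add_im, Complex.add_re, Complex.sub_im, Complex.sub_re, Complex.mul_im,
    Complex.mul_re, Complex.ofReal_im, Complex.ofReal_re, Complex.zero_im, Complex.zero_re]
    at him hre
  have hq := norm_sub_re_sq q
  have hnn := sq_nonneg ‖q - re q • (1 : Oct)‖
  have hcq : c.re = re q := by
    have : c.im * (c.re - re q) = 0 := by linarith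
    rcases mul_eq_zero.1 this with h0 | h0
    · rw [h0] at hre
      nlinarith [sq_nonneg (c.re - re q)]
    · linarith
  refine mem_qSphere_iff.2 ⟨(re_toSlice hJ c).trans hcq,
    (sq_eq_sq₀ (norm_nonneg _) (norm_nonneg _)).1 ?_⟩
  rw [norm_toSlice_sq hJ, hcq]
  rw [hcq] at hre
  linarith

/-- `x ↦ x s - q x` maps `ℂ_J + q ℂ_J` onto itself and is right `ℂ_J`-linear there. -/
lemma exists_slicePair_preimage {q J : Oct} (hJ : J ∈ unitSphere) {c : ℂ}
    (h : toSlice J c ∉ qSphere q) (z w : ℂ) :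
    ∃ z' w' : ℂ, ∀ t : ℂ,
      slicePair q J (z' * t) (w' * t) * toSlice J c - q * slicePair q J (z' * t) (w' * t) =
        slicePair q J (z * t) (w * t) := by
  have hD := charpoly_ne_zero hJ h
  set D := c * c - (2 * re q : ℝ) * c + (‖q‖ ^ 2 : ℝ) with hDdef
  refine ⟨(c - (2 * re q : ℝ)) * ((z + c * w) / D) - w, (z + c * w) / D, fun t => ?_⟩
  have hd : (z + c * w) / D * D = z + c * w := div_mul_cancel₀ _ hD
  rw [slicePair_mul_toSlice hJ, mul_slicePair, slicePair_sub]
  congr 1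
  · linear_combination t * hd - t * ((z + c * w) / D) * hDdef
  · ring

section LeftMultiplication

lemma Lq_pow_eq (q : Oct) (n : ℕ) : ∃ a b : ℝ, Lq q ^ n = a • 1 + b • Lq q := by
  induction n with
  | zero => exact ⟨1, 0, by simp⟩
  | succ n ih =>
    obtain ⟨a, b, h⟩ := ih
    refine ⟨-(b * ‖q‖ ^ 2), a + b * (2 * re q), ?_⟩
    ext1 x
    rw [pow_succ, h]
    simp only [mul_apply_eq_comp, add_apply,
      smul_apply, one_apply_eq_self, Lq_apply, left_alternative,
      mul_self_eq q, sub_mul, smul_mul_assoc, one_mul]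
    module

variable [OctBimodule Oct]

lemma reO_oct_apply (hlm : ∀ p x : Oct, lmo p x = p * x) (hrm : ∀ p x : Oct, rmo p x = x * p)
    (y : Oct) : reO Oct y = re y • (1 : Oct) := by
  simp only [reO, Fin.sum_univ_seven, sub_apply,
    smul_apply, add_apply,
    ContinuousLinearMap.comp_apply, ContinuousLinearMap.id_apply, hlm, hrm]
  apply ext_re <;> simp [re] <;> ring

lemma isPowerAssoc_Lq (hlm : ∀ p x : Oct, lmo p x = p * x)
    (hrm : ∀ p x : Oct, rmo p x = x * p) (q : Oct) : IsPowerAssoc (Lq q) := by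
  intro n p x
  obtain ⟨a, b, h⟩ := Lq_pow_eq q n
  have hB : Bop p (Lq q ^ n) x = b • (q * x * p - q * (x * p)) := by
    rw [h]
    simp only [Bop, sub_apply, ContinuousLinearMap.comp_apply,
      add_apply, smul_apply,
      one_apply_eq_self, Lq_apply, hrm, add_mul, smul_mul_assoc]
    module
  have hre : re (q * x * p - q * (x * p)) = 0 := sub_eq_zero.2 (re_mul_assoc q x p)
  rw [hB, reO_oct_apply hlm hrm, re_smul, hre, mul_zero, zero_smul]

lemma rmo_sub_Lq_apply (hrm : ∀ p x : Oct, rmo p x = x * p) (q s x : Oct) :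
    ((rmo s : Oct →L[ℝ] Oct) - Lq q) x = x * s - q * x := by
  rw [sub_apply, hrm, Lq_apply]

lemma isUnit_rmo_sub_Lq_iff (hrm : ∀ p x : Oct, rmo p x = x * p) (q s : Oct) :
    IsUnit ((rmo s : Oct →L[ℝ] Oct) - Lq q) ↔ s ∉ qSphere q := by
  rw [ContinuousLinearMap.isUnit_iff_bijective]
  constructor
  · intro hb hs
    obtain ⟨x, hx, h⟩ := exists_mul_eq_mul_of_mem_qSphere hs
    refine hx (hb.1 ?_)
    rw [rmo_sub_Lq_apply hrm, h, sub_self, map_zero]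
  · intro hs
    have hinj : Function.Injective ((rmo s : Oct →L[ℝ] Oct) - Lq q) := by
      refine (injective_iff_map_eq_zero _).2 fun x hx => ?_
      rw [rmo_sub_Lq_apply hrm] at hx
      by_contra hx0
      exact hs (mem_qSphere_of_mul_eq_mul hx0 (sub_eq_zero.1 hx))
    exact ⟨hinj, LinearMap.surjective_of_injective
      (f := (((rmo s : Oct →L[ℝ] Oct) - Lq q : Oct →L[ℝ] Oct) : Oct →ₗ[ℝ] Oct)) hinj⟩

lemma inverse_rmo_sub_Lq_apply (hrm : ∀ p x : Oct, rmo p x = x * p) {q s : Oct}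
    (hs : s ∉ qSphere q) {x y : Oct} (h : x * s - q * x = y) :
    Ring.inverse ((rmo s : Oct →L[ℝ] Oct) - Lq q) y = x := by
  rw [← h, ← rmo_sub_Lq_apply hrm, ← mul_apply_eq_comp,
    Ring.inverse_mul_cancel _ ((isUnit_rmo_sub_Lq_iff hrm q s).2 hs),
    one_apply_eq_self]

lemma extO_eq_Lq (hlm : ∀ p x : Oct, lmo p x = p * x) (hrm : ∀ p x : Oct, rmo p x = x * p)
    (G : Oct →L[ℝ] Oct) : extO G = Lq (G 1) := by
  ext1 y
  conv_rhs => rw [← sum_re_smul_e y]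
  simp only [extO, sum_apply, ContinuousLinearMap.comp_apply, hrm,
    reO_oct_apply hlm hrm, map_smul, map_sum, Lq_apply, smul_mul_assoc]

lemma rinvR_rmo_sub_Lq (hlm : ∀ p x : Oct, lmo p x = p * x)
    (hrm : ∀ p x : Oct, rmo p x = x * p) {q s : Oct}
    (hQ : q * q - (2 * re s) • q + (‖s‖ ^ 2) • (1 : Oct) ≠ 0) :
    rinvR ((rmo s : Oct →L[ℝ] Oct) - Lq q) =
      Lq (oinv (q * q - (2 * re s) • q + (‖s‖ ^ 2) • (1 : Oct)) * (conj s - q)) := by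
  rw [rinvR, extO_eq_Lq hlm hrm, inverse_rmo_sub_Lq_apply hrm
    (fun hs => hQ (qpoly_eq_zero_of_mem_qSphere hs)) (oinv_qpoly_mul_solves hQ)]

lemma eq_re_smul_one_of_mem_ReSet (hlm : ∀ p x : Oct, lmo p x = p * x)
    (hrm : ∀ p x : Oct, rmo p x = x * p) {v : Oct} (hv : v ∈ ReSet Oct) :
    v = re v • (1 : Oct) :=
  eq_re_smul_one_of_commute fun p => by rw [← hlm, hv.2 p, hrm]

lemma inverse_pow_slicePair (hrm : ∀ p x : Oct, rmo p x = x * p) {q J : Oct}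
    (hJ : J ∈ unitSphere) {c : ℂ} (hs : toSlice J c ∉ qSphere q) (n : ℕ) (z w : ℂ) :
    ∃ z' w' : ℂ, ∀ t : ℂ,
      (Ring.inverse ((rmo (toSlice J c) : Oct →L[ℝ] Oct) - Lq q) ^ n)
        (slicePair q J (z * t) (w * t)) = slicePair q J (z' * t) (w' * t) := by
  induction n generalizing z w with
  | zero => exact ⟨z, w, fun t => rfl⟩
  | succ n ih =>
    obtain ⟨z₁, w₁, h₁⟩ := exists_slicePair_preimage hJ hs z w
    obtain ⟨z₂, w₂, h₂⟩ := ih z₁ w₁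
    refine ⟨z₂, w₂, fun t => ?_⟩
    rw [pow_succ, mul_apply_eq_comp, inverse_rmo_sub_Lq_apply hrm hs (h₁ t), h₂]

lemma cjExtPA_inverse_rmo_sub_Lq (hlm : ∀ p x : Oct, lmo p x = p * x)
    (hrm : ∀ p x : Oct, rmo p x = x * p) {q J : Oct} (hJ : J ∈ unitSphere) {c : ℂ}
    (hs : toSlice J c ∉ qSphere q) :
    CJExtPA J (Ring.inverse ((rmo (toSlice J c) : Oct →L[ℝ] Oct) - Lq q)) := by
  rintro n - v hv _ ⟨x, y, rfl⟩
  obtain ⟨z, w, h⟩ := inverse_pow_slicePair hrm hJ hs n (re v) 0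
  have hp (t : ℂ) : v * toSlice J t = slicePair q J (re v * t) (0 * t) := by
    conv_lhs => rw [eq_re_smul_one_of_mem_ReSet hlm hrm hv]
    simp only [slicePair, toSlice_ofReal_mul, smul_mul_assoc, one_mul, zero_mul]
    simp [toSlice]
  have h1 : toSlice J 1 = 1 := by simp [toSlice]
  have hv1 : v = slicePair q J (re v * 1) (0 * 1) := by rw [← hp, h1, mul_one]
  change _ = rmo (toSlice J ⟨x, y⟩) _
  rw [show x • (1 : Oct) + y • J = toSlice J ⟨x, y⟩ from rfl, hrm, hrm, hp, h]
  conv_rhs => rw [hv1, h, slicePair_mul_toSlice hJ, mul_one, mul_one]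

lemma pbSpec_Lq (hlm : ∀ p x : Oct, lmo p x = p * x) (hrm : ∀ p x : Oct, rmo p x = x * p)
    (q : Oct) : pbSpec (Lq q) = qSphere q := by
  ext s
  simp only [pbSpec, pbRes, pbResSlice, Set.mem_sdiff, Set.mem_univ, true_and, Set.mem_iUnion,
    Set.mem_ofPred_eq, isUnit_rmo_sub_Lq_iff hrm, exists_prop]
  constructor
  · intro h
    by_contra hs
    obtain ⟨J, hJ, z, rfl⟩ := exists_mem_sliceC s
    exact h ⟨J, hJ, ⟨z.re, z.im, rfl⟩, hs, cjExtPA_inverse_rmo_sub_Lq hlm hrm hJ hs⟩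
  · rintro hs ⟨J, -, -, hs', -⟩
    exact hs' hs

end LeftMultiplication

end Oct

/-- Let `q ∈ 𝕆` be a nonzero octonion and `L_q : x ↦ qx` the left
multiplication operator on the Banach `𝕆`-bimodule `𝕆` (whose bimodule multiplications are
the octonion product).  Then: (1) `L_q` is power-associative; (2) `R_s − L_q` is invertible
iff `s ∉ [q] = {Re q + |Im q| J : J ∈ 𝕊}`; (3) for `J ∈ 𝕊` and `s ∈ ℂ_J` with
`Q_s(q) = q² − 2(Re s)q + |s|² ≠ 0`, `(R_s − L_q)^{⊚−} = L_{Q_s(q)^{−1}(s̄ − q)}`;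
(4) `σ*(L_q) = [q]`. -/
theorem statement_18 [OctBimodule Oct]
    (hlm : ∀ p x : Oct, lmo p x = p * x) (hrm : ∀ p x : Oct, rmo p x = x * p)
    (q : Oct) (hq : q ≠ 0) :
    IsPowerAssoc (Oct.Lq q) ∧
    (∀ s : Oct, IsUnit ((rmo s : Oct →L[ℝ] Oct) - Oct.Lq q) ↔ s ∉ Oct.qSphere q) ∧
    (∀ J ∈ unitSphere, ∀ s ∈ sliceC J,
      q * q - (2 * Oct.re s) • q + (‖s‖ ^ 2) • (1 : Oct) ≠ 0 →
      rinvR ((rmo s : Oct →L[ℝ] Oct) - Oct.Lq q) =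
        Oct.Lq (Oct.oinv (q * q - (2 * Oct.re s) • q + (‖s‖ ^ 2) • (1 : Oct)) *
          (Oct.conj s - q))) ∧
    pbSpec (Oct.Lq q) = Oct.qSphere q := by
  exact ⟨isPowerAssoc_Lq hlm hrm q, isUnit_rmo_sub_Lq_iff hrm q,
    fun _ _ _ _ hQ => rinvR_rmo_sub_Lq hlm hrm hQ, pbSpec_Lq hlm hrm q⟩
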